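/- Let S be a nonzero ℂ-linear subspace of the d×d complex matrices. Then lim_{n→∞} (mrk(S^{⊗n}))^{1/n} = d if and only if S has no shrunk subspace. Equivalently, if S has a shrunk subspace then lim_{n→∞} (mrk(S^{⊗n}))^{1/n} < d. -/

import Mathlib

open Matrix

noncomputable def mrk {m n : Type*} [Fintype m] [Fintype n]
    (S : Submodule ℂ (Matrix m n ℂ)) : ℕ :=
  sSup (Matrix.rank '' (S : Set (Matrix m n ℂ)))

noncomputable def tensorSpace {m₁ n₁ m₂ n₂ : Type*}
    (S : Submodule ℂ (Matrix m₁ n₁ ℂ)) (T : Submodule ℂ (Matrix m₂ n₂ ℂ)) :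
    Submodule ℂ (Matrix (m₁ × m₂) (n₁ × n₂) ℂ) :=
  Submodule.span ℂ {M | ∃ A ∈ S, ∃ B ∈ T, M = Matrix.kroneckerMap (· * ·) A B}

noncomputable def tensorPow {d : ℕ} (S : Submodule ℂ (Matrix (Fin d) (Fin d) ℂ)) (n : ℕ) :
    Submodule ℂ (Matrix (Fin n → Fin d) (Fin n → Fin d) ℂ) :=
  Submodule.span ℂ {M | ∃ A : Fin n → Matrix (Fin d) (Fin d) ℂ,
    (∀ k, A k ∈ S) ∧ M = fun i j => ∏ k, A k (i k) (j k)}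

noncomputable def spaceImageOf {ι κ : Type*} [Fintype κ]
    (S : Submodule ℂ (Matrix ι κ ℂ)) (U : Submodule ℂ (κ → ℂ)) : Submodule ℂ (ι → ℂ) :=
  Submodule.span ℂ {v | ∃ A ∈ S, ∃ u ∈ U, v = A.mulVec u}

def HasShrunkSubspace {ι : Type*} [Fintype ι]
    (S : Submodule ℂ (Matrix ι ι ℂ)) : Prop :=
  ∃ U : Submodule ℂ (ι → ℂ),
    Module.finrank ℂ (spaceImageOf S U) < Module.finrank ℂ U

noncomputable def compSpace (p q m n : ℕ) : Submodule ℂ (Matrix (Fin m) (Fin n) ℂ) where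
  carrier := {A | ∀ (i : Fin m) (j : Fin n), p ≤ (i : ℕ) → q ≤ (j : ℕ) → A i j = 0}
  add_mem' := by
    intro a b ha hb i j hi hj
    simp only [Matrix.add_apply, ha i j hi hj, hb i j hi hj, add_zero]
  zero_mem' := by intro i j _ _; rfl
  smul_mem' := by
    intro c a ha i j hi hj
    simp only [Matrix.smul_apply, ha i j hi hj, smul_zero]

open Filter Topology

lemma rank_le_mrk {m n : Type*} [Fintype m] [Fintype n] {S : Submodule ℂ (Matrix m n ℂ)}
    {A : Matrix m n ℂ} (hA : A ∈ S) : A.rank ≤ mrk S :=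
  le_csSup ⟨Fintype.card n, by rintro _ ⟨B, -, rfl⟩; exact B.rank_le_card_width⟩ ⟨A, hA, rfl⟩

lemma exists_rank_eq_mrk {m n : Type*} [Fintype m] [Fintype n]
    (S : Submodule ℂ (Matrix m n ℂ)) : ∃ A ∈ S, A.rank = mrk S :=
  Nat.sSup_mem (s := Matrix.rank '' (S : Set (Matrix m n ℂ))) ⟨_, 0, S.zero_mem, rfl⟩
    ⟨Fintype.card n, by rintro _ ⟨B, -, rfl⟩; exact B.rank_le_card_width⟩

/-- The Kronecker product of a finite sequence of matrices, indexed by multi-indices. -/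
def piKron {n : ℕ} {ι κ : Type*} (A : Fin n → Matrix ι κ ℂ) :
    Matrix (Fin n → ι) (Fin n → κ) ℂ :=
  fun i j => ∏ k, A k (i k) (j k)

lemma piKron_mul {n : ℕ} {ι κ μ : Type*} [Fintype κ]
    (A : Fin n → Matrix ι κ ℂ) (B : Fin n → Matrix κ μ ℂ) :
    piKron A * piKron B = piKron fun k => A k * B k := by
  classical
  ext i j
  simp only [piKron, Matrix.mul_apply, ← Finset.prod_mul_distrib]
  rw [Finset.prod_univ_sum, Fintype.piFinset_univ]

lemma piKron_one {n : ℕ} {ι : Type*} [DecidableEq ι] :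
    piKron (fun _ : Fin n => (1 : Matrix ι ι ℂ)) = 1 := by
  ext i j
  by_cases h : i = j
  · subst h
    simp [piKron]
  · obtain ⟨k, hk⟩ := Function.ne_iff.mp h
    rw [Matrix.one_apply_ne h]
    exact Finset.prod_eq_zero (Finset.mem_univ k) (Matrix.one_apply_ne hk)

lemma piKron_conjTranspose {n : ℕ} {ι κ : Type*} (A : Fin n → Matrix ι κ ℂ) :
    (piKron A)ᴴ = piKron fun k => (A k)ᴴ := by
  ext i j
  simp [piKron, Matrix.conjTranspose_apply]

lemma trace_piKron {n : ℕ} {ι : Type*} [Fintype ι] (A : Fin n → Matrix ι ι ℂ) :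
    (piKron A).trace = ∏ k, (A k).trace := by
  classical
  simp only [Matrix.trace, Matrix.diag, piKron]
  rw [Finset.prod_univ_sum, Fintype.piFinset_univ]

lemma sum_piKron {n : ℕ} {ι κ α : Type*} [Fintype α] (A : α → Matrix ι κ ℂ) :
    ∑ I : Fin n → α, piKron (fun k => A (I k)) = piKron fun _ => ∑ a, A a := by
  classical
  ext i j
  simp only [Matrix.sum_apply, piKron]
  rw [Finset.prod_univ_sum, Fintype.piFinset_univ]

lemma piKron_mem_tensorPow {d n : ℕ} {S : Submodule ℂ (Matrix (Fin d) (Fin d) ℂ)}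
    {A : Fin n → Matrix (Fin d) (Fin d) ℂ} (hA : ∀ k, A k ∈ S) : piKron A ∈ tensorPow S n :=
  Submodule.subset_span ⟨A, hA, rfl⟩

lemma exists_mul_mul_eq_one {m n : Type*} [Fintype m] [Fintype n] [DecidableEq m] [DecidableEq n]
    (M : Matrix m n ℂ) :
    ∃ (X : Matrix (Fin M.rank) m ℂ) (Y : Matrix n (Fin M.rank) ℂ), X * M * Y = 1 := by
  set f := Matrix.toLin' M
  have hr : Module.finrank ℂ (LinearMap.range f) = M.rank := rfl
  let b := Module.finBasisOfFinrankEq ℂ (LinearMap.range f) hr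
  obtain ⟨s, hs⟩ := f.rangeRestrict.exists_rightInverse_of_surjective f.range_rangeRestrict
  obtain ⟨t, ht⟩ := (LinearMap.range f).subtype.exists_leftInverse_of_injective
    (Submodule.ker_subtype _)
  refine ⟨LinearMap.toMatrix' (b.equivFun.toLinearMap ∘ₗ t),
    LinearMap.toMatrix' (s ∘ₗ b.equivFun.symm.toLinearMap), ?_⟩
  have hM : M = LinearMap.toMatrix' f := (LinearMap.toMatrix'_toLin' M).symm
  refine (congrArg (_ * · * _) hM).trans ?_
  rw [← LinearMap.toMatrix'_comp, ← LinearMap.toMatrix'_comp, ← LinearMap.toMatrix'_id]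
  congr 1
  refine LinearMap.ext fun v => ?_
  have h1 : f (s (b.equivFun.symm v)) = (b.equivFun.symm v : LinearMap.range f) := by
    have := LinearMap.congr_fun hs (b.equivFun.symm v)
    simpa using congrArg Subtype.val this
  have h2 : t (b.equivFun.symm v : LinearMap.range f) = b.equivFun.symm v :=
    LinearMap.congr_fun ht _
  change b.equivFun (t (f (s (b.equivFun.symm v)))) = v
  rw [h1, h2, LinearEquiv.apply_symm_apply]

lemma rank_mul_rank_le_rank_kronecker {m n m' n' : Type*} [Fintype m] [Fintype n] [Fintype m']
    [Fintype n'] (M : Matrix m n ℂ) (N : Matrix m' n' ℂ) :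
    M.rank * N.rank ≤ (Matrix.kroneckerMap (· * ·) M N).rank := by
  classical
  obtain ⟨X, Y, h⟩ := exists_mul_mul_eq_one M
  obtain ⟨X', Y', h'⟩ := exists_mul_mul_eq_one N
  have key : Matrix.kroneckerMap (· * ·) X X' * Matrix.kroneckerMap (· * ·) M N *
      Matrix.kroneckerMap (· * ·) Y Y' = 1 := by
    rw [← Matrix.mul_kronecker_mul, ← Matrix.mul_kronecker_mul, h, h', Matrix.one_kronecker_one]
  calc M.rank * N.rank = (1 : Matrix (Fin M.rank × Fin N.rank) (Fin M.rank × Fin N.rank) ℂ).rank := by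
        simp [Matrix.rank_one]
    _ ≤ _ := by
        rw [← key]
        exact (Matrix.rank_mul_le_left _ _).trans (Matrix.rank_mul_le_right _ _)

/-- The Kronecker product of two matrices on multi-indices, as a matrix on concatenated
multi-indices. -/
def appendKron {m n : ℕ} {ι κ : Type*} (M : Matrix (Fin m → ι) (Fin m → κ) ℂ)
    (N : Matrix (Fin n → ι) (Fin n → κ) ℂ) : Matrix (Fin (m + n) → ι) (Fin (m + n) → κ) ℂ :=
  fun i j => M (fun k => i (Fin.castAdd n k)) (fun k => j (Fin.castAdd n k)) *
    N (fun k => i (Fin.natAdd m k)) (fun k => j (Fin.natAdd m k))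

lemma appendKron_mem_tensorPow {d m n : ℕ} {S : Submodule ℂ (Matrix (Fin d) (Fin d) ℂ)}
    {M : Matrix (Fin m → Fin d) (Fin m → Fin d) ℂ} {N : Matrix (Fin n → Fin d) (Fin n → Fin d) ℂ}
    (hM : M ∈ tensorPow S m) (hN : N ∈ tensorPow S n) :
    appendKron M N ∈ tensorPow S (m + n) := by
  induction hM using Submodule.span_induction with
  | zero =>
    convert Submodule.zero_mem (tensorPow S (m + n)) using 1
    ext i j; simp [appendKron]
  | add x y _ _ hx hy =>
    convert Submodule.add_mem _ hx hy using 1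
    ext i j; simp [appendKron, add_mul]
  | smul a x _ hx =>
    convert Submodule.smul_mem _ a hx using 1
    ext i j; simp [appendKron, mul_assoc]
  | mem x hx =>
    obtain ⟨A, hA, rfl⟩ := hx
    induction hN using Submodule.span_induction with
    | zero =>
      convert Submodule.zero_mem (tensorPow S (m + n)) using 1
      ext i j; simp [appendKron]
    | add x y _ _ hx hy =>
      convert Submodule.add_mem _ hx hy using 1
      ext i j; simp [appendKron, mul_add]
    | smul a x _ hx =>
      convert Submodule.smul_mem _ a hx using 1
      ext i j; simp [appendKron]; ring
    | mem y hy =>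
      obtain ⟨B, hB, rfl⟩ := hy
      refine Submodule.subset_span ⟨Fin.append A B, fun k => ?_, ?_⟩
      · refine Fin.addCases (fun k => ?_) (fun k => ?_) k
        · simpa using hA k
        · simpa using hB k
      · ext i j
        simp [appendKron, Fin.prod_univ_add]

lemma rank_mul_rank_le_rank_appendKron {d m n : ℕ}
    (M : Matrix (Fin m → Fin d) (Fin m → Fin d) ℂ) (N : Matrix (Fin n → Fin d) (Fin n → Fin d) ℂ) :
    M.rank * N.rank ≤ (appendKron M N).rank := by
  have h : (appendKron M N).submatrix (Fin.appendEquiv m n) (Fin.appendEquiv m n) =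
      Matrix.kroneckerMap (· * ·) M N := by
    ext i j
    simp [appendKron, Fin.appendEquiv]
  rw [← Matrix.rank_submatrix (appendKron M N) (Fin.appendEquiv m n) (Fin.appendEquiv m n), h]
  exact rank_mul_rank_le_rank_kronecker M N

lemma mrk_tensorPow_mul_le {d : ℕ} (S : Submodule ℂ (Matrix (Fin d) (Fin d) ℂ)) (m n : ℕ) :
    mrk (tensorPow S m) * mrk (tensorPow S n) ≤ mrk (tensorPow S (m + n)) := by
  obtain ⟨M, hM, h1⟩ := exists_rank_eq_mrk (tensorPow S m)
  obtain ⟨N, hN, h2⟩ := exists_rank_eq_mrk (tensorPow S n)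
  rw [← h1, ← h2]
  exact (rank_mul_rank_le_rank_appendKron M N).trans (rank_le_mrk (appendKron_mem_tensorPow hM hN))

lemma mrk_tensorPow_le {d : ℕ} (S : Submodule ℂ (Matrix (Fin d) (Fin d) ℂ)) (n : ℕ) :
    mrk (tensorPow S n) ≤ d ^ n := by
  obtain ⟨M, -, h⟩ := exists_rank_eq_mrk (tensorPow S n)
  rw [← h]
  simpa using M.rank_le_card_width

lemma one_le_mrk_tensorPow {d : ℕ} {S : Submodule ℂ (Matrix (Fin d) (Fin d) ℂ)} (hS : S ≠ ⊥)
    (n : ℕ) : 1 ≤ mrk (tensorPow S n) := by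
  obtain ⟨A, hA, hA0⟩ := S.exists_mem_ne_zero_of_ne_bot hS
  refine le_trans ?_ (rank_le_mrk (piKron_mem_tensorPow (n := n) (A := fun _ => A) fun _ => hA))
  rw [Nat.one_le_iff_ne_zero, Ne, Matrix.rank, Submodule.finrank_eq_zero, LinearMap.range_eq_bot]
  intro h
  replace h : piKron (fun _ => A) = 0 := Matrix.ext_of_mulVec_single fun i =>
    (LinearMap.congr_fun h (Pi.single i 1)).trans (Matrix.zero_mulVec _).symm
  obtain ⟨i, j, hij⟩ : ∃ i j, A i j ≠ 0 := by
    by_contra! h'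
    exact hA0 (Matrix.ext h')
  have := congrFun (congrFun h fun _ => i) fun _ => j
  simp [piKron, hij] at this

lemma tendsto_mul_pow_rpow_inv {C g : ℝ} (hC : 0 < C) (hg : 0 < g) :
    Tendsto (fun n : ℕ => (C * g ^ n) ^ ((n : ℝ)⁻¹)) atTop (𝓝 g) := by
  have h1 : Tendsto (fun n : ℕ => C ^ ((n : ℝ)⁻¹)) atTop (𝓝 1) := by
    have := (Real.continuousAt_const_rpow hC.ne' (b := 0)).tendsto.comp
      (tendsto_inv_atTop_nhds_zero_nat (𝕜 := ℝ))
    simpa [Function.comp_def] using this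
  have h2 := h1.mul_const g
  rw [one_mul] at h2
  refine h2.congr' ?_
  filter_upwards [eventually_ne_atTop 0] with n hn
  rw [Real.mul_rpow hC.le (by positivity), Real.pow_rpow_inv_natCast hg.le hn]

lemma exists_tendsto_mrk_tensorPow {d : ℕ} {S : Submodule ℂ (Matrix (Fin d) (Fin d) ℂ)}
    (hS : S ≠ ⊥) : ∃ L : ℝ, L ≤ d ∧
      Tendsto (fun n : ℕ => (mrk (tensorPow S n) : ℝ) ^ ((n : ℝ)⁻¹)) atTop (𝓝 L) := by
  have hpos (n : ℕ) : (0 : ℝ) < mrk (tensorPow S n) := by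
    exact_mod_cast one_le_mrk_tensorPow hS n
  have hle (n : ℕ) : (mrk (tensorPow S n) : ℝ) ≤ (d : ℝ) ^ n := by
    exact_mod_cast mrk_tensorPow_le S n
  have hsub : Subadditive fun n => -Real.log (mrk (tensorPow S n)) := by
    intro m n
    have : ((mrk (tensorPow S m) : ℝ) * mrk (tensorPow S n)) ≤ mrk (tensorPow S (m + n)) := by
      exact_mod_cast mrk_tensorPow_mul_le S m n
    have := Real.log_le_log (mul_pos (hpos m) (hpos n)) this
    rw [Real.log_mul (hpos m).ne' (hpos n).ne'] at this
    linarith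
  have hbdd : BddBelow (Set.range fun n : ℕ => -Real.log (mrk (tensorPow S n)) / n) := by
    refine ⟨-|Real.log d|, ?_⟩
    rintro _ ⟨n, rfl⟩
    rcases Nat.eq_zero_or_pos n with rfl | hn
    · simp
    · have hn' : (0 : ℝ) < n := by exact_mod_cast hn
      have := Real.log_le_log (hpos n) (hle n)
      rw [Real.log_pow] at this
      change _ ≤ -Real.log (mrk (tensorPow S n)) / n
      rw [le_div_iff₀ hn']
      nlinarith [le_abs_self (Real.log d)]
  have hlim : Tendsto (fun n : ℕ => (mrk (tensorPow S n) : ℝ) ^ ((n : ℝ)⁻¹)) atTop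
      (𝓝 (Real.exp (-hsub.lim))) := by
    refine ((Real.continuous_exp.tendsto _).comp (hsub.tendsto_lim hbdd).neg).congr fun n => ?_
    rw [Real.rpow_def_of_pos (hpos n)]
    simp only [Function.comp]
    congr 1
    ring
  refine ⟨_, le_of_tendsto hlim ?_, hlim⟩
  filter_upwards [eventually_ne_atTop 0] with n hn
  calc (mrk (tensorPow S n) : ℝ) ^ ((n : ℝ)⁻¹) ≤ ((d : ℝ) ^ n) ^ ((n : ℝ)⁻¹) :=
        Real.rpow_le_rpow (hpos n).le (hle n) (by positivity)
    _ = d := Real.pow_rpow_inv_natCast (by positivity) hn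

lemma limit_le_of_le_mul_pow {a : ℕ → ℕ} {L C g : ℝ} (hC : 0 < C) (hg : 0 < g)
    (ha : Tendsto (fun n : ℕ => (a n : ℝ) ^ ((n : ℝ)⁻¹)) atTop (𝓝 L))
    (h : ∀ n, (a n : ℝ) ≤ C * g ^ n) : L ≤ g :=
  le_of_tendsto_of_tendsto' ha (tendsto_mul_pow_rpow_inv hC hg) fun n =>
    Real.rpow_le_rpow (by positivity) (h n) (by positivity)

lemma le_limit_of_mul_pow_le {a : ℕ → ℕ} {L C g : ℝ} (hC : 0 < C) (hg : 0 < g)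
    (ha : Tendsto (fun n : ℕ => (a n : ℝ) ^ ((n : ℝ)⁻¹)) atTop (𝓝 L))
    (h : ∀ n, C * g ^ n ≤ a n) : g ≤ L :=
  le_of_tendsto_of_tendsto' (tendsto_mul_pow_rpow_inv hC hg) ha fun n =>
    Real.rpow_le_rpow (by positivity) (h n) (by positivity)

lemma Matrix.rank_add_le_add {m n : Type*} [Fintype m] [Fintype n] (A B : Matrix m n ℂ) :
    (A + B).rank ≤ A.rank + B.rank := by
  unfold Matrix.rank
  rw [Matrix.mulVecLin_add]
  refine (Submodule.finrank_mono ?_).trans (Submodule.finrank_add_le_finrank_add_finrank _ _)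
  rintro _ ⟨v, rfl⟩
  exact Submodule.add_mem_sup ⟨v, rfl⟩ ⟨v, rfl⟩

lemma rank_le_card_add_card_of_forall_eq_zero {m n : Type*} [Fintype m] [Fintype n]
    [DecidableEq m] [DecidableEq n] (M : Matrix m n ℂ) (R : Finset m) (C : Finset n)
    (h : ∀ i ∉ R, ∀ j ∉ C, M i j = 0) : M.rank ≤ R.card + C.card := by
  set DR : Matrix m m ℂ := Matrix.diagonal fun i => if i ∈ R then 1 else 0
  set DC : Matrix n n ℂ := Matrix.diagonal fun j => if j ∈ C then 1 else 0
  have hR : DR.rank = R.card := by simp [DR, Matrix.rank_diagonal]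
  have hC : DC.rank = C.card := by simp [DC, Matrix.rank_diagonal]
  have hM : M = DR * M + (M - DR * M) * DC := by
    ext i j
    simp only [DR, DC, Matrix.add_apply, Matrix.mul_diagonal, Matrix.sub_apply,
      Matrix.diagonal_mul]
    by_cases hi : i ∈ R <;> by_cases hj : j ∈ C <;> simp [hi, hj]
    exact h i hi j hj
  calc M.rank = (DR * M + (M - DR * M) * DC).rank := by rw [← hM]
    _ ≤ (DR * M).rank + ((M - DR * M) * DC).rank := Matrix.rank_add_le_add _ _
    _ ≤ R.card + C.card := by
        rw [← hR, ← hC]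
        exact add_le_add (Matrix.rank_mul_le_left _ _) (Matrix.rank_mul_le_right _ _)

/-- The exponential-moment bound on the number of words with many or few letters in `J`. -/
lemma card_filter_count_le {d : ℕ} (J : Finset (Fin d)) (l a : ℝ) (n : ℕ) :
    ((Finset.univ.filter fun j : Fin n → Fin d =>
      l * (Finset.univ.filter fun k => j k ∈ J).card ≤ l * (a * n)).card : ℝ) ≤
      (J.card * Real.exp (l * (a - 1)) + (d - J.card) * Real.exp (l * a)) ^ n := by
  set w : Fin d → ℝ := fun x => if x ∈ J then Real.exp (l * (a - 1)) else Real.exp (l * a)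
  have hw0 (x) : 0 < w x := by dsimp only [w]; split_ifs <;> positivity
  have hsum : ∑ x, w x = J.card * Real.exp (l * (a - 1)) + (d - J.card) * Real.exp (l * a) := by
    have hle : J.card ≤ d := by simpa using J.card_le_univ
    simp only [w, Finset.sum_ite, Finset.sum_const, nsmul_eq_mul]
    rw [Finset.filter_not, Finset.card_sdiff]
    simp [Nat.cast_sub hle]
  have hprod (j : Fin n → Fin d) : ∏ k, w (j k) =
      Real.exp (l * (a * n) - l * (Finset.univ.filter fun k => j k ∈ J).card) := by
    have : ∀ k, w (j k) = Real.exp (l * a - l * if j k ∈ J then 1 else 0) := by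
      intro k
      dsimp only [w]
      split_ifs <;> congr 1 <;> ring
    simp only [this, ← Real.exp_sum, Finset.sum_sub_distrib, ← Finset.mul_sum]
    congr 1
    rw [Finset.sum_boole, Finset.sum_const, Finset.card_univ, Fintype.card_fin, nsmul_eq_mul]
    ring
  rw [← hsum, ← Fin.prod_const, Finset.prod_univ_sum, Fintype.piFinset_univ,
    Finset.card_eq_sum_ones, Nat.cast_sum]
  refine (Finset.sum_le_sum fun j hj => ?_).trans
    (Finset.sum_le_sum_of_subset_of_nonneg (Finset.filter_subset _ _) fun j _ _ =>
      Finset.prod_nonneg fun k _ => (hw0 _).le)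
  rw [hprod, Nat.cast_one]
  exact Real.one_le_exp (sub_nonneg.2 (Finset.mem_filter.1 hj).2)

/-- With the tilt `(q - d a) / (2 d)`, the exponential moment drops below its value at `0`. -/
lemma exp_moment_lt {d q a : ℝ} (hd : 0 < d) (hq0 : 0 ≤ q) (hqd : q ≤ d) (ha0 : 0 ≤ a)
    (ha1 : a ≤ 1) (hne : q ≠ d * a) :
    q * Real.exp ((q - d * a) / (2 * d) * (a - 1)) + (d - q) * Real.exp ((q - d * a) / (2 * d) * a)
      < d := by
  set l := (q - d * a) / (2 * d) with hl
  have hl1 : |l| ≤ 1 := by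
    rw [hl, abs_div, abs_of_pos (show (0 : ℝ) < 2 * d by positivity), div_le_one (by positivity),
      abs_le]
    constructor <;> nlinarith
  have hexp {x : ℝ} (hx : |x| ≤ 1) : Real.exp (l * x) ≤ 1 + l * x + l ^ 2 := by
    have h1 : |l * x| ≤ 1 := by
      rw [abs_mul]; exact mul_le_one₀ hl1 (abs_nonneg _) hx
    have h2 := (abs_le.1 (Real.abs_exp_sub_one_sub_id_le h1)).2
    have h3 : x ^ 2 ≤ 1 := (sq_le_one_iff_abs_le_one _).2 hx
    nlinarith [mul_nonneg (sq_nonneg l) (sub_nonneg.2 h3)]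
  have e1 := hexp (x := a - 1) (by rw [abs_le]; constructor <;> linarith)
  have e2 := hexp (x := a) (by rw [abs_le]; constructor <;> linarith)
  have hld : 2 * d * l = q - d * a := by rw [hl]; field_simp
  have hl0 : 0 < l ^ 2 := by
    refine sq_pos_of_ne_zero fun h0 => hne ?_
    rw [h0] at hld
    linarith
  have hkey : l * (q - d * a) = 2 * d * l ^ 2 := by rw [← hld]; ring
  nlinarith [mul_le_mul_of_nonneg_left e1 hq0, mul_le_mul_of_nonneg_left e2 (sub_nonneg.2 hqd),
    mul_pos hd hl0]

lemma exists_matrix_adapted {d : ℕ} (U : Submodule ℂ (Fin d → ℂ)) :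
    ∃ (X Y : Matrix (Fin d) (Fin d) ℂ) (J : Finset (Fin d)), X * Y = 1 ∧ Y * X = 1 ∧
      J.card = Module.finrank ℂ U ∧ (∀ j ∈ J, (fun i => Y i j) ∈ U) ∧
      ∀ u ∈ U, ∀ j ∉ J, (X *ᵥ u) j = 0 := by
  obtain ⟨W, hW⟩ := U.exists_isCompl
  have hdim : Module.finrank ℂ U + Module.finrank ℂ W = d := by
    simpa using Submodule.finrank_add_eq_of_isCompl hW
  let bU := Module.finBasis ℂ U
  let bW := Module.finBasis ℂ W
  let e : Fin (Module.finrank ℂ U) ⊕ Fin (Module.finrank ℂ W) ≃ Fin d :=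
    finSumFinEquiv.trans (finCongr hdim)
  let b : Module.Basis (Fin d) ℂ (Fin d → ℂ) :=
    ((bU.prod bW).map (U.prodEquivOfIsCompl W hW)).reindex e
  let J : Finset (Fin d) := Finset.univ.map (Function.Embedding.inl.trans e.toEmbedding)
  have hbJ : ∀ j ∈ J, b j ∈ U := by
    intro j hj
    obtain ⟨k, -, rfl⟩ := Finset.mem_map.1 hj
    simp [b]
  refine ⟨LinearMap.toMatrix' b.equivFun.toLinearMap, LinearMap.toMatrix' b.equivFun.symm.toLinearMap,
    J, ?_, ?_, by simp [J], ?_, ?_⟩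
  · rw [← LinearMap.toMatrix'_comp]; simp
  · rw [← LinearMap.toMatrix'_comp]; simp
  · intro j hj
    convert hbJ j hj using 1
    ext i
    have hs : Pi.single j 1 = b.equivFun (b j) := by
      ext k
      simp [Pi.single_apply, eq_comm]
    change b.equivFun.symm (Pi.single j 1) i = b j i
    rw [hs, LinearEquiv.symm_apply_apply]
  · intro u hu j hj
    rw [LinearMap.toMatrix'_mulVec]
    obtain ⟨k, rfl⟩ := e.surjective j
    rcases k with k | k
    · exact absurd (Finset.mem_map.2 ⟨k, Finset.mem_univ _, rfl⟩) hj
    · have : (U.prodEquivOfIsCompl W hW).symm u = ((⟨u, hu⟩ : U), (0 : W)) :=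
        Submodule.prodEquivOfIsCompl_symm_apply_left U W hW ⟨u, hu⟩
      simp [b, this]

lemma exists_lt_mrk_tensorPow_le {d : ℕ} {S : Submodule ℂ (Matrix (Fin d) (Fin d) ℂ)}
    (h : HasShrunkSubspace S) :
    ∃ g : ℝ, 0 < g ∧ g < d ∧ ∀ n, (mrk (tensorPow S n) : ℝ) ≤ 2 * g ^ n := by
  obtain ⟨U, hU⟩ := h
  obtain ⟨X, Y, J, hXY, hYX, hJ, hYJ, -⟩ := exists_matrix_adapted U
  obtain ⟨X', Y', I, hXY', hYX', hI, -, hXI'⟩ := exists_matrix_adapted (spaceImageOf S U)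
  rw [← hJ, ← hI] at hU
  have hJd : J.card ≤ d := by simpa using J.card_le_univ
  have hd : (0 : ℝ) < d := by exact_mod_cast (Nat.zero_le _).trans_lt (hU.trans_le hJd)
  have hIJ : (I.card : ℝ) < J.card := by exact_mod_cast hU
  have hJd' : (J.card : ℝ) ≤ d := by exact_mod_cast hJd
  have hI0 : (0 : ℝ) ≤ I.card := by positivity
  set a : ℝ := (I.card + J.card) / (2 * d) with ha
  have had : d * a = (I.card + J.card) / 2 := by rw [ha]; field_simp
  have ha0 : 0 ≤ a := by positivity
  have ha1 : a ≤ 1 := by rw [ha, div_le_one (by positivity)]; linarith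
  set l : ℝ → ℝ := fun q => (q - d * a) / (2 * d)
  have hl (q : ℝ) : 2 * d * l q = q - d * a := by simp only [l]; field_simp
  set γ : ℝ → ℝ := fun q => q * Real.exp (l q * (a - 1)) + (d - q) * Real.exp (l q * a)
  have hlJ : 0 < l J.card := by simp only [l]; exact div_pos (by linarith) (by positivity)
  have hlI : l I.card < 0 := by
    simp only [l]; exact div_neg_of_neg_of_pos (by linarith) (by positivity)
  have hγJ : γ J.card < d := exp_moment_lt hd (by positivity) hJd' ha0 ha1 (by linarith)
  have hγI : γ I.card < d := exp_moment_lt hd hI0 (by linarith) ha0 ha1 (by linarith)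
  have hγJ0 : 0 < γ J.card := add_pos_of_pos_of_nonneg
    (mul_pos (by linarith) (Real.exp_pos _)) (mul_nonneg (by linarith) (Real.exp_pos _).le)
  have hγI0 : 0 < γ I.card := add_pos_of_nonneg_of_pos
    (mul_nonneg hI0 (Real.exp_pos _).le) (mul_pos (by linarith) (Real.exp_pos _))
  refine ⟨max (γ J.card) (γ I.card), lt_max_of_lt_left hγJ0, max_lt hγJ hγI, fun n => ?_⟩
  have hzero : ∀ A ∈ S, ∀ i ∉ I, ∀ j ∈ J, (X' * A * Y) i j = 0 := by
    intro A hA i hi j hj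
    have := hXI' (A *ᵥ fun k => Y k j) (Submodule.subset_span ⟨A, hA, _, hYJ j hj, rfl⟩) i hi
    rw [Matrix.mulVec_mulVec] at this
    exact this
  obtain ⟨M, hM, hr⟩ := exists_rank_eq_mrk (tensorPow S n)
  set G := piKron fun _ : Fin n => X'
  set G' := piKron fun _ : Fin n => Y'
  set H := piKron fun _ : Fin n => Y
  set H' := piKron fun _ : Fin n => X
  have hG : G' * G = 1 := by
    simp only [G, G', piKron_mul, hYX', piKron_one]
  have hH : H * H' = 1 := by
    simp only [H, H', piKron_mul, hYX, piKron_one]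
  have hpat : ∀ i j : Fin n → Fin d, (∃ k, i k ∉ I ∧ j k ∈ J) → (G * M * H) i j = 0 := by
    rintro i j ⟨k, hik, hjk⟩
    clear hr
    induction hM using Submodule.span_induction with
    | zero => simp
    | add x y _ _ hx hy => simp [mul_add, add_mul, hx, hy]
    | smul c x _ hx => simp [hx]
    | mem x hx =>
      obtain ⟨A, hA, rfl⟩ := hx
      change (G * piKron A * H) i j = 0
      simp only [G, H, piKron_mul]
      exact Finset.prod_eq_zero (Finset.mem_univ k) (hzero _ (hA k) _ hik _ hjk)
  have hrank : M.rank ≤ (G * M * H).rank := by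
    have : M = G' * (G * M * H) * H' := by
      rw [show G' * (G * M * H) * H' = (G' * G) * M * (H * H') by simp only [Matrix.mul_assoc],
        hG, hH, Matrix.one_mul, Matrix.mul_one]
    conv_lhs => rw [this]
    exact (Matrix.rank_mul_le_left _ _).trans (Matrix.rank_mul_le_right _ _)
  set C := Finset.univ.filter fun j : Fin n → Fin d =>
      l J.card * (Finset.univ.filter fun k => j k ∈ J).card ≤ l J.card * (a * n)
  set R := Finset.univ.filter fun i : Fin n → Fin d =>
      l I.card * (Finset.univ.filter fun k => i k ∈ I).card ≤ l I.card * (a * n)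
  have hRC : ∀ i ∉ R, ∀ j ∉ C, (G * M * H) i j = 0 := by
    intro i hi j hj
    simp only [R, C, Finset.mem_filter, Finset.mem_univ, true_and, not_le] at hi hj
    have hi' := (mul_lt_mul_left_of_neg hlI).1 hi
    have hj' := (mul_lt_mul_iff_right₀ hlJ).1 hj
    apply hpat
    by_contra! hcon
    have : (Finset.univ.filter fun k => j k ∈ J).card ≤ (Finset.univ.filter fun k => i k ∈ I).card := by
      refine Finset.card_le_card fun k hk => ?_
      simp only [Finset.mem_filter, Finset.mem_univ, true_and] at hk ⊢
      by_contra h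
      exact hcon k h hk
    have : ((Finset.univ.filter fun k => j k ∈ J).card : ℝ) ≤
      (Finset.univ.filter fun k => i k ∈ I).card := by exact_mod_cast this
    linarith
  have hfin := hrank.trans (rank_le_card_add_card_of_forall_eq_zero _ R C hRC)
  rw [hr] at hfin
  have hC : (C.card : ℝ) ≤ γ J.card ^ n := card_filter_count_le J _ a n
  have hR : (R.card : ℝ) ≤ γ I.card ^ n := card_filter_count_le I _ a n
  have h1 := pow_le_pow_left₀ hγJ0.le (le_max_left (γ J.card) (γ I.card)) n
  have h2 := pow_le_pow_left₀ hγI0.le (le_max_right (γ J.card) (γ I.card)) n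
  have h3 : (mrk (tensorPow S n) : ℝ) ≤ R.card + C.card := by exact_mod_cast hfin
  linarith

lemma Matrix.IsHermitian.exists_unitary_diagonal {n : Type*} [Fintype n] [DecidableEq n]
    {A : Matrix n n ℂ} (hA : A.IsHermitian) :
    ∃ U ∈ Matrix.unitaryGroup n ℂ,
      A = U * Matrix.diagonal (fun i => (hA.eigenvalues i : ℂ)) * Uᴴ :=
  ⟨hA.eigenvectorUnitary, hA.eigenvectorUnitary.2, hA.spectral_theorem⟩

lemma conjTranspose_mul_self_of_mem_unitaryGroup {n : Type*} [Fintype n] [DecidableEq n]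
    {U : Matrix n n ℂ} (hU : U ∈ Matrix.unitaryGroup n ℂ) : Uᴴ * U = 1 :=
  Matrix.mem_unitaryGroup_iff'.1 hU

lemma Matrix.IsHermitian.trace_mul_self_eq_sum {n : Type*} [Fintype n] [DecidableEq n]
    {A : Matrix n n ℂ} (hA : A.IsHermitian) :
    (A * A).trace = ((∑ i, hA.eigenvalues i ^ 2 : ℝ) : ℂ) := by
  obtain ⟨U, hU, h⟩ := hA.exists_unitary_diagonal
  have hU' := conjTranspose_mul_self_of_mem_unitaryGroup hU
  set D := Matrix.diagonal (fun i => (hA.eigenvalues i : ℂ)) with hD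
  have : A * A = U * (D * D) * Uᴴ := by
    calc A * A = U * D * Uᴴ * (U * D * Uᴴ) := by rw [← h]
      _ = U * D * (Uᴴ * U) * D * Uᴴ := by simp only [Matrix.mul_assoc]
      _ = _ := by rw [hU', Matrix.mul_one, Matrix.mul_assoc U]
  rw [this, Matrix.trace_mul_comm, ← Matrix.mul_assoc, hU', Matrix.one_mul, hD,
    Matrix.diagonal_mul_diagonal, Matrix.trace_diagonal]
  simp [sq]

open scoped ComplexOrder in
lemma trace_self_mul_conjTranspose_sq_le {n m : Type*} [Fintype n] [Fintype m] [DecidableEq n]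
    (M : Matrix n m ℂ) :
    (M * Mᴴ).trace.re ^ 2 ≤ M.rank * (M * Mᴴ * (M * Mᴴ)).trace.re := by
  have hA : (M * Mᴴ).IsHermitian := Matrix.isHermitian_mul_conjTranspose_self M
  rw [← Matrix.rank_self_mul_conjTranspose M, hA.rank_eq_card_non_zero_eigs,
    hA.trace_mul_self_eq_sum, hA.trace_eq_sum_eigenvalues, Fintype.card_subtype]
  have h1 : (∑ i, (RCLike.ofReal (hA.eigenvalues i) : ℂ)).re =
      ∑ i ∈ Finset.univ.filter fun i => hA.eigenvalues i ≠ 0, hA.eigenvalues i := by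
    rw [Finset.sum_filter_ne_zero]
    simp
  rw [h1, Complex.ofReal_re]
  refine sq_sum_le_card_mul_sum_sq.trans ?_
  exact mul_le_mul_of_nonneg_left (Finset.sum_le_sum_of_subset_of_nonneg
    (Finset.filter_subset _ _) fun i _ _ => sq_nonneg (hA.eigenvalues i)) (Nat.cast_nonneg _)

lemma trace_mul_self_re_nonneg {n : Type*} [Fintype n]
    {A : Matrix n n ℂ} (hA : A.IsHermitian) : 0 ≤ (A * A).trace.re := by
  classical
  rw [hA.trace_mul_self_eq_sum, Complex.ofReal_re]
  positivity

/-- The fourth roots of unity. -/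
noncomputable def quarterPhase : Fin 4 → ℂ := ![1, -1, Complex.I, -Complex.I]

lemma sum_quarterPhase_mul_conjTranspose {n m : Type*} [Fintype m] (X A : Matrix n m ℂ) :
    ∑ k, (X + quarterPhase k • A) * (X + quarterPhase k • A)ᴴ = (4 : ℂ) • (X * Xᴴ + A * Aᴴ) := by
  simp only [Fin.sum_univ_four, quarterPhase, Matrix.conjTranspose_add, Matrix.conjTranspose_smul,
    Matrix.add_mul, Matrix.mul_add, Matrix.smul_mul, Matrix.mul_smul]
  ext i j
  simp
  ring_nf
  simp
  ring

lemma sum_quarterPhase_conjTranspose_mul {n m : Type*} [Fintype n] (X A : Matrix n m ℂ) :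
    ∑ k, (X + quarterPhase k • A)ᴴ * (X + quarterPhase k • A) = (4 : ℂ) • (Xᴴ * X + Aᴴ * A) := by
  simp only [Fin.sum_univ_four, quarterPhase, Matrix.conjTranspose_add, Matrix.conjTranspose_smul,
    Matrix.add_mul, Matrix.mul_add, Matrix.smul_mul, Matrix.mul_smul]
  ext i j
  simp
  ring_nf
  simp
  ring

lemma sum_quarterPhase_trace {n m : Type*} [Fintype n] [Fintype m] (X A : Matrix n m ℂ) :
    ∑ k, ((X + quarterPhase k • A) * (X + quarterPhase k • A)ᴴ *
        ((X + quarterPhase k • A) * (X + quarterPhase k • A)ᴴ)).trace =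
      4 * ((X * Xᴴ * (X * Xᴴ)).trace + 2 * ((X * Xᴴ) * (A * Aᴴ)).trace +
        2 * ((Xᴴ * X) * (Aᴴ * A)).trace + (A * Aᴴ * (A * Aᴴ)).trace) := by
  have h1 : (A * Aᴴ * (X * Xᴴ)).trace = (X * Xᴴ * (A * Aᴴ)).trace := Matrix.trace_mul_comm _ _
  have h2 : (X * Aᴴ * (A * Xᴴ)).trace = ((Xᴴ * X) * (Aᴴ * A)).trace := by
    rw [← Matrix.mul_assoc, Matrix.trace_mul_comm]; simp only [Matrix.mul_assoc]
  have h3 : (A * Xᴴ * (X * Aᴴ)).trace = ((Xᴴ * X) * (Aᴴ * A)).trace := by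
    rw [Matrix.trace_mul_comm, h2]
  simp only [Fin.sum_univ_four, quarterPhase, Matrix.conjTranspose_add, Matrix.conjTranspose_smul,
    Matrix.add_mul, Matrix.mul_add, Matrix.smul_mul, Matrix.mul_smul, Matrix.trace_add,
    Matrix.trace_smul, h1, h2, h3]
  simp
  ring_nf
  simp
  ring

lemma exists_average {n m α : Type*} [Fintype n] [Fintype m] (A : α → Matrix n m ℂ)
    (s : Finset α) :
    ∃ (Ω : Type) (_ : Fintype Ω) (_ : Nonempty Ω) (M : Ω → Matrix n m ℂ),
      (∀ w, M w ∈ Submodule.span ℂ (Set.range A)) ∧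
      ∑ w, M w * (M w)ᴴ = (Fintype.card Ω : ℂ) • ∑ a ∈ s, A a * (A a)ᴴ ∧
      ∑ w, (M w)ᴴ * M w = (Fintype.card Ω : ℂ) • ∑ a ∈ s, (A a)ᴴ * A a ∧
      ∑ w, (M w * (M w)ᴴ * (M w * (M w)ᴴ)).trace.re ≤ Fintype.card Ω *
        (((∑ a ∈ s, A a * (A a)ᴴ) * ∑ a ∈ s, A a * (A a)ᴴ).trace.re +
          ((∑ a ∈ s, (A a)ᴴ * A a) * ∑ a ∈ s, (A a)ᴴ * A a).trace.re) := by
  classical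
  induction s using Finset.induction_on with
  | empty =>
    refine ⟨Unit, inferInstance, inferInstance, fun _ => 0, fun _ => Submodule.zero_mem _, ?_⟩
    simp
  | insert a s ha ih =>
    obtain ⟨Ω, _, _, M, hM, h1, h2, h3⟩ := ih
    refine ⟨Ω × Fin 4, inferInstance, inferInstance, fun w => M w.1 + quarterPhase w.2 • A a,
      fun w => Submodule.add_mem _ (hM _)
        (Submodule.smul_mem _ _ (Submodule.subset_span ⟨a, rfl⟩)), ?_, ?_, ?_⟩
    · rw [Fintype.sum_prod_type]
      simp only [sum_quarterPhase_mul_conjTranspose]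
      rw [← Finset.smul_sum, Finset.sum_add_distrib, h1, Finset.sum_insert ha]
      simp [← Nat.cast_smul_eq_nsmul ℂ, smul_smul, mul_comm]
      abel
    · rw [Fintype.sum_prod_type]
      simp only [sum_quarterPhase_conjTranspose_mul]
      rw [← Finset.smul_sum, Finset.sum_add_distrib, h2, Finset.sum_insert ha]
      simp [← Nat.cast_smul_eq_nsmul ℂ, smul_smul, mul_comm]
      abel
    · rw [Fintype.sum_prod_type]
      simp only [Finset.sum_insert ha]
      set P := ∑ a ∈ s, A a * (A a)ᴴ
      set Q := ∑ a ∈ s, (A a)ᴴ * A a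
      have e1 : ∑ w, (M w * (M w)ᴴ * (A a * (A a)ᴴ)).trace.re =
          Fintype.card Ω * (P * (A a * (A a)ᴴ)).trace.re := by
        rw [← Complex.re_sum, ← Matrix.trace_sum, ← Finset.sum_mul, h1]
        simp
      have e2 : ∑ w, ((M w)ᴴ * (M w) * ((A a)ᴴ * A a)).trace.re =
          Fintype.card Ω * (Q * ((A a)ᴴ * A a)).trace.re := by
        rw [← Complex.re_sum, ← Matrix.trace_sum, ← Finset.sum_mul, h2]
        simp
      have e3 : ∀ w, ∑ k, ((M w + quarterPhase k • A a) * (M w + quarterPhase k • A a)ᴴ *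
            ((M w + quarterPhase k • A a) * (M w + quarterPhase k • A a)ᴴ)).trace.re =
          4 * ((M w * (M w)ᴴ * (M w * (M w)ᴴ)).trace.re +
            2 * (M w * (M w)ᴴ * (A a * (A a)ᴴ)).trace.re +
            2 * ((M w)ᴴ * M w * ((A a)ᴴ * A a)).trace.re +
            (A a * (A a)ᴴ * (A a * (A a)ᴴ)).trace.re) := by
        intro w
        rw [← Complex.re_sum, sum_quarterPhase_trace]
        simp
      have hnn := trace_mul_self_re_nonneg (Matrix.isHermitian_conjTranspose_mul_self (A a))
      have c1 : (A a * (A a)ᴴ * P).trace = (P * (A a * (A a)ᴴ)).trace := Matrix.trace_mul_comm _ _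
      have c2 : ((A a)ᴴ * A a * Q).trace = (Q * ((A a)ᴴ * A a)).trace := Matrix.trace_mul_comm _ _
      simp only [e3]
      rw [← Finset.mul_sum]
      simp only [Finset.sum_add_distrib, ← Finset.mul_sum, e1, e2, Matrix.mul_add,
        Matrix.add_mul, Matrix.trace_add, Complex.add_re, c1, c2]
      simp only [Finset.sum_const, Finset.card_univ, Fintype.card_prod, Fintype.card_fin,
        nsmul_eq_mul, Nat.cast_mul, Nat.cast_ofNat]
      nlinarith [mul_nonneg (Nat.cast_nonneg (α := ℝ) (Fintype.card Ω)) hnn]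

lemma trace_sq_le_rank_bound_mul {n m α : Type*} [Fintype n] [Fintype m] [Fintype α]
    (A : α → Matrix n m ℂ) (r : ℕ) (hr : ∀ M ∈ Submodule.span ℂ (Set.range A), M.rank ≤ r) :
    (∑ a, A a * (A a)ᴴ).trace.re ^ 2 ≤ r *
      (((∑ a, A a * (A a)ᴴ) * ∑ a, A a * (A a)ᴴ).trace.re +
        ((∑ a, (A a)ᴴ * A a) * ∑ a, (A a)ᴴ * A a).trace.re) := by
  classical
  obtain ⟨Ω, _, _, M, hM, h1, -, h3⟩ := exists_average A Finset.univ
  set P := ∑ a, A a * (A a)ᴴ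
  set Q := ∑ a, (A a)ᴴ * A a
  have hc : (0 : ℝ) < Fintype.card Ω := by exact_mod_cast Fintype.card_pos
  have e1 : ∑ w, (M w * (M w)ᴴ).trace.re = Fintype.card Ω * P.trace.re := by
    rw [← Complex.re_sum, ← Matrix.trace_sum, h1]
    simp
  have e2 : (∑ w, (M w * (M w)ᴴ).trace.re) ^ 2 ≤
      Fintype.card Ω * ∑ w, (M w * (M w)ᴴ).trace.re ^ 2 := by
    simpa using sq_sum_le_card_mul_sum_sq (s := Finset.univ) (f := fun w => (M w * (M w)ᴴ).trace.re)
  have e3 : ∑ w, (M w * (M w)ᴴ).trace.re ^ 2 ≤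
      ∑ w, r * (M w * (M w)ᴴ * (M w * (M w)ᴴ)).trace.re := by
    refine Finset.sum_le_sum fun w _ => (trace_self_mul_conjTranspose_sq_le (M w)).trans ?_
    refine mul_le_mul_of_nonneg_right (by exact_mod_cast hr _ (hM w))
      (trace_mul_self_re_nonneg (Matrix.isHermitian_mul_conjTranspose_self (M w)))
  rw [← Finset.mul_sum] at e3
  rw [e1] at e2
  have e4 := e3.trans (mul_le_mul_of_nonneg_left h3 (Nat.cast_nonneg r))
  have e5 := e2.trans (mul_le_mul_of_nonneg_left e4 hc.le)
  have hc2 : (0 : ℝ) < (Fintype.card Ω : ℝ) ^ 2 := by positivity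
  refine le_of_mul_le_mul_left ?_ hc2
  calc _ = ((Fintype.card Ω : ℝ) * P.trace.re) ^ 2 := by ring
    _ ≤ _ := e5
    _ = _ := by ring

/-- The square of the Frobenius norm. -/
noncomputable def frobSq {m n : Type*} [Fintype m] [Fintype n] (A : Matrix m n ℂ) : ℝ :=
  ∑ i, ∑ j, Complex.normSq (A i j)

lemma frobSq_nonneg {m n : Type*} [Fintype m] [Fintype n] (A : Matrix m n ℂ) : 0 ≤ frobSq A :=
  Finset.sum_nonneg fun _ _ => Finset.sum_nonneg fun _ _ => Complex.normSq_nonneg _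

lemma trace_mul_conjTranspose_self_eq {m n : Type*} [Fintype m] [Fintype n] (A : Matrix m n ℂ) :
    (A * Aᴴ).trace = (frobSq A : ℂ) := by
  simp [frobSq, Matrix.trace, Matrix.mul_apply, Complex.mul_conj]

lemma frobSq_conjTranspose {m n : Type*} [Fintype m] [Fintype n] (A : Matrix m n ℂ) :
    frobSq Aᴴ = frobSq A := by
  unfold frobSq
  rw [Finset.sum_comm]
  simp

lemma frobSq_mul_congr {m n l : Type*} [Fintype m] [Fintype n] [Fintype l]
    {g k : Matrix m n ℂ} (h : gᴴ * g = kᴴ * k) (B : Matrix n l ℂ) :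
    frobSq (g * B) = frobSq (k * B) := by
  have key (g : Matrix m n ℂ) : (frobSq (g * B) : ℂ) = (gᴴ * g * (B * Bᴴ)).trace := by
    rw [← trace_mul_conjTranspose_self_eq, Matrix.conjTranspose_mul, Matrix.mul_assoc gᴴ,
      Matrix.trace_mul_comm gᴴ]
    simp only [Matrix.mul_assoc]
  exact_mod_cast (key g).trans ((congrArg (fun X => (X * (B * Bᴴ)).trace) h).trans (key k).symm)

/-- Left multiplication changes the Frobenius norm like the nonnegative diagonal part of a singular
value decomposition. -/
lemma exists_unitary_frobSq_mul_eq {n : Type*} [Fintype n] [DecidableEq n] (g : Matrix n n ℂ) :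
    ∃ U ∈ Matrix.unitaryGroup n ℂ, ∃ x : n → ℝ, (∏ i, x i ^ 2 = ‖g.det‖ ^ 2) ∧
      ∀ B : Matrix n n ℂ,
        frobSq (g * B) = frobSq (Matrix.diagonal (fun i => (x i : ℂ)) * (U * B)) := by
  have hH : (gᴴ * g).IsHermitian := Matrix.isHermitian_conjTranspose_mul_self g
  have hP : ∀ i, 0 ≤ hH.eigenvalues i :=
    fun i => Matrix.eigenvalues_conjTranspose_mul_self_nonneg g i
  obtain ⟨V, hV, h⟩ := hH.exists_unitary_diagonal
  refine ⟨Vᴴ, Unitary.star_mem hV, fun i => Real.sqrt (hH.eigenvalues i), ?_, fun B => ?_⟩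
  · have hdet := hH.det_eq_prod_eigenvalues
    rw [Matrix.det_mul, Matrix.det_conjTranspose] at hdet
    have : ((‖g.det‖ ^ 2 : ℝ) : ℂ) = ((∏ i, hH.eigenvalues i : ℝ) : ℂ) := by
      push_cast
      rw [← Complex.conj_mul']
      exact hdet
    rw [Complex.ofReal_inj.1 this]
    exact Finset.prod_congr rfl fun i _ => Real.sq_sqrt (hP i)
  · rw [← Matrix.mul_assoc]
    refine frobSq_mul_congr ?_ B
    conv_lhs => rw [h]
    rw [Matrix.conjTranspose_mul, Matrix.conjTranspose_conjTranspose,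
      Matrix.diagonal_conjTranspose]
    have : (Matrix.diagonal fun i => (hH.eigenvalues i : ℂ)) =
        Matrix.diagonal (star fun i => ((Real.sqrt (hH.eigenvalues i) : ℝ) : ℂ)) *
          Matrix.diagonal fun i => ((Real.sqrt (hH.eigenvalues i) : ℝ) : ℂ) := by
      rw [Matrix.diagonal_mul_diagonal]
      congr 1
      ext i
      simp only [Pi.star_apply, Complex.star_def, Complex.conj_ofReal]
      rw [← Complex.ofReal_mul, Real.mul_self_sqrt (hP i)]
    rw [this]
    simp only [Matrix.mul_assoc]

lemma isCompact_unitaryGroup {n : Type*} [Fintype n] [DecidableEq n] :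
    IsCompact (Matrix.unitaryGroup n ℂ : Set (Matrix n n ℂ)) := by
  have hbox : IsCompact (Set.univ.pi fun _ : n => Set.univ.pi fun _ : n =>
      Metric.closedBall (0 : ℂ) 1) :=
    isCompact_univ_pi fun _ => isCompact_univ_pi fun _ => isCompact_closedBall _ _
  refine hbox.of_isClosed_subset ?_ fun U hU i _ j _ => ?_
  · have : (Matrix.unitaryGroup n ℂ : Set (Matrix n n ℂ)) = {U | U * Uᴴ = 1} := by
      ext U
      exact Matrix.mem_unitaryGroup_iff
    rw [this]
    exact isClosed_eq (by fun_prop) continuous_const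
  · rw [mem_closedBall_zero_iff]
    exact entry_norm_bound_of_unitary hU i j

/-- The total weight of the `(j, k)` entries of a family of matrices, in the bases given by `U`
and `V`. -/
noncomputable def entryWeight {n α : Type*} [Fintype n] [Fintype α] (A : α → Matrix n n ℂ)
    (U V : Matrix n n ℂ) (j k : n) : ℝ :=
  ∑ a, Complex.normSq ((U * A a * V) j k)

lemma exists_perm_entryWeight_pos {n α : Type*} [Fintype n] [DecidableEq n] [Fintype α]
    {A : α → Matrix n n ℂ} (hA : ¬ HasShrunkSubspace (Submodule.span ℂ (Set.range A)))
    {U V : Matrix n n ℂ} (hU : U ∈ Matrix.unitaryGroup n ℂ) (hV : V ∈ Matrix.unitaryGroup n ℂ) :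
    ∃ σ : Equiv.Perm n, ∀ k, 0 < entryWeight A U V (σ k) k := by
  classical
  let t : n → Finset n := fun k => Finset.univ.filter fun j => ∃ a, (U * A a * V) j k ≠ 0
  have hall : ∀ s : Finset n, s.card ≤ (s.biUnion t).card := by
    intro s
    by_contra! hlt
    refine hA ⟨Submodule.span ℂ (Set.range fun k : s => Vᵀ k), ?_⟩
    have hVu : IsUnit V := (Matrix.isUnit_iff_isUnit_det _).2
      (Matrix.isUnit_det_of_left_inverse (conjTranspose_mul_self_of_mem_unitaryGroup hV))
    have hli : LinearIndependent ℂ fun k : s => Vᵀ k :=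
      (Matrix.linearIndependent_cols_iff_isUnit.2 hVu).comp _ Subtype.val_injective
    rw [finrank_span_eq_card hli, Fintype.card_coe]
    refine lt_of_le_of_lt ?_ hlt
    set W := Submodule.span ℂ (Set.range fun j : s.biUnion t => (Uᴴ)ᵀ j) with hW
    have hWdim : Module.finrank ℂ W ≤ (s.biUnion t).card :=
      (finrank_range_le_card _).trans (Fintype.card_coe _).le
    refine (Submodule.finrank_mono (Submodule.span_le.2 ?_)).trans hWdim
    rintro _ ⟨B, hB, u, hu, rfl⟩
    change B *ᵥ u ∈ W
    induction hB using Submodule.span_induction with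
    | zero => simp
    | add x y _ _ hx hy => rw [Matrix.add_mulVec]; exact W.add_mem hx hy
    | smul c x _ hx => rw [Matrix.smul_mulVec]; exact W.smul_mem c hx
    | mem x hx =>
      obtain ⟨a, rfl⟩ := hx
      induction hu using Submodule.span_induction with
      | zero => simp
      | add x y _ _ hx hy => rw [Matrix.mulVec_add]; exact W.add_mem hx hy
      | smul c x _ hx => rw [Matrix.mulVec_smul]; exact W.smul_mem c hx
      | mem x hx =>
        obtain ⟨k, rfl⟩ := hx
        have hsum : A a *ᵥ Vᵀ k = ∑ j, (U * A a * V) j k • (Uᴴ)ᵀ j := by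
          have : Uᴴ * (U * A a * V) = A a * V := by
            rw [Matrix.mul_assoc, ← Matrix.mul_assoc Uᴴ,
              conjTranspose_mul_self_of_mem_unitaryGroup hU, Matrix.one_mul]
          ext i
          have := congrFun (congrFun this i) k
          rw [Matrix.mul_apply] at this
          simp only [Finset.sum_apply, Pi.smul_apply, smul_eq_mul]
          simp only [Matrix.transpose_apply, mul_comm ((U * A a * V) _ _)]
          rw [this]
          rfl
        rw [hsum]
        refine W.sum_mem fun j _ => ?_
        by_cases hj : (U * A a * V) j k = 0
        · simp [hj]
        · refine W.smul_mem _ (Submodule.subset_span ⟨⟨j, ?_⟩, rfl⟩)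
          exact Finset.mem_biUnion.2 ⟨k, k.2, Finset.mem_filter.2 ⟨Finset.mem_univ _, a, hj⟩⟩
  obtain ⟨f, hf, hft⟩ := (Finset.all_card_le_biUnion_card_iff_exists_injective t).1 hall
  refine ⟨Equiv.ofBijective f (Finite.injective_iff_bijective.1 hf), fun k => ?_⟩
  obtain ⟨a, ha⟩ := (Finset.mem_filter.1 (hft k)).2
  exact Finset.sum_pos' (fun _ _ => Complex.normSq_nonneg _)
    ⟨a, Finset.mem_univ _, Complex.normSq_pos.2 ha⟩

lemma entryWeight_nonneg {n α : Type*} [Fintype n] [Fintype α] (A : α → Matrix n n ℂ)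
    (U V : Matrix n n ℂ) (j k : n) : 0 ≤ entryWeight A U V j k :=
  Finset.sum_nonneg fun _ _ => Complex.normSq_nonneg _

lemma exists_pos_le_sum_prod_entryWeight {n α : Type*} [Fintype n] [DecidableEq n] [Fintype α]
    {A : α → Matrix n n ℂ} (hA : ¬ HasShrunkSubspace (Submodule.span ℂ (Set.range A))) :
    ∃ c : ℝ, 0 < c ∧ ∀ U ∈ Matrix.unitaryGroup n ℂ, ∀ V ∈ Matrix.unitaryGroup n ℂ,
      c ≤ ∑ σ : Equiv.Perm n, ∏ k, entryWeight A U V (σ k) k := by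
  have hφ : Continuous fun p : Matrix n n ℂ × Matrix n n ℂ =>
      ∑ σ : Equiv.Perm n, ∏ k, entryWeight A p.1 p.2 (σ k) k := by
    have hentry (a : α) (j k : n) :
        Continuous fun p : Matrix n n ℂ × Matrix n n ℂ => (p.1 * A a * p.2) j k :=
      ((continuous_fst.matrix_mul continuous_const).matrix_mul continuous_snd).matrix_elem j k
    have hweight (j k : n) :
        Continuous fun p : Matrix n n ℂ × Matrix n n ℂ => entryWeight A p.1 p.2 j k :=
      continuous_finsetSum _ fun a _ => Complex.continuous_normSq.comp (hentry a j k)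
    exact continuous_finsetSum _ fun σ _ => continuous_finsetProd _ fun k _ => hweight (σ k) k
  obtain ⟨⟨U₀, V₀⟩, hp, hmin⟩ :=
    (isCompact_unitaryGroup.prod isCompact_unitaryGroup).exists_isMinOn
      ⟨((1 : Matrix n n ℂ), (1 : Matrix n n ℂ)), one_mem _, one_mem _⟩ hφ.continuousOn
  refine ⟨∑ σ : Equiv.Perm n, ∏ k, entryWeight A U₀ V₀ (σ k) k, ?_, fun U hU V hV =>
    isMinOn_iff.1 hmin (U, V) ⟨hU, hV⟩⟩
  obtain ⟨σ, hσ⟩ := exists_perm_entryWeight_pos hA hp.1 hp.2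
  exact Finset.sum_pos' (fun _ _ => Finset.prod_nonneg fun _ _ => entryWeight_nonneg _ _ _ _ _)
    ⟨σ, Finset.mem_univ _, Finset.prod_pos fun k _ => hσ k⟩

/-- A matrix space without shrunk subspaces is bounded away from `0` along its orbit under
left-right multiplication by matrices of unit determinant. -/
lemma exists_pos_le_sum_frobSq {n α : Type*} [Fintype n] [DecidableEq n] [Nonempty n] [Fintype α]
    {A : α → Matrix n n ℂ} (hA : ¬ HasShrunkSubspace (Submodule.span ℂ (Set.range A))) :
    ∃ c : ℝ, 0 < c ∧ ∀ g h : Matrix n n ℂ, ‖g.det‖ = 1 → ‖h.det‖ = 1 →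
      c ≤ ∑ a, frobSq (g * A a * h) := by
  obtain ⟨c, hc, hcle⟩ := exists_pos_le_sum_prod_entryWeight hA
  set F : ℝ := (Fintype.card (Equiv.Perm n) : ℝ)
  have hF : 0 < F := by simp only [F]; exact_mod_cast Fintype.card_pos
  refine ⟨min 1 (c / F), lt_min one_pos (by positivity), fun g h hg hh => ?_⟩
  obtain ⟨U, hU, x, hx, hgx⟩ := exists_unitary_frobSq_mul_eq g
  obtain ⟨V, hV, y, hy, hhy⟩ := exists_unitary_frobSq_mul_eq hᴴ
  have hdet : ‖hᴴ.det‖ = 1 := by rw [Matrix.det_conjTranspose, norm_star, hh]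
  rw [hg, one_pow] at hx
  rw [hdet, one_pow] at hy
  set w := entryWeight A U Vᴴ
  have hw0 : ∀ j k, 0 ≤ w j k := entryWeight_nonneg A U Vᴴ
  have hN : ∑ a, frobSq (g * A a * h) = ∑ j, ∑ k, x j ^ 2 * y k ^ 2 * w j k := by
    have h1 (a : α) : frobSq (g * A a * h) =
        ∑ j, ∑ k, x j ^ 2 * y k ^ 2 * Complex.normSq ((U * A a * Vᴴ) j k) := by
      rw [Matrix.mul_assoc, hgx, ← Matrix.mul_assoc, ← Matrix.mul_assoc, ← frobSq_conjTranspose,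
        Matrix.conjTranspose_mul, hhy, ← frobSq_conjTranspose]
      unfold frobSq
      refine Finset.sum_congr rfl fun j _ => Finset.sum_congr rfl fun k _ => ?_
      have : (Matrix.diagonal (fun i => (y i : ℂ)) *
          (V * (Matrix.diagonal (fun i => (x i : ℂ)) * U * A a)ᴴ))ᴴ j k =
          x j * (U * A a * Vᴴ) j k * y k := by
        rw [Matrix.conjTranspose_mul, Matrix.conjTranspose_mul, Matrix.conjTranspose_conjTranspose,
          Matrix.diagonal_conjTranspose, Matrix.mul_diagonal, Matrix.mul_assoc, Matrix.mul_assoc,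
          Matrix.diagonal_mul, ← Matrix.mul_assoc]
        simp
      rw [this, Complex.normSq_mul, Complex.normSq_mul, Complex.normSq_ofReal,
        Complex.normSq_ofReal]
      ring
    simp only [h1, w, entryWeight, Finset.mul_sum]
    rw [Finset.sum_comm]
    exact Finset.sum_congr rfl fun j _ => Finset.sum_comm
  set N := ∑ a, frobSq (g * A a * h)
  have hN0 : 0 ≤ N := Finset.sum_nonneg fun _ _ => frobSq_nonneg _
  have hterm (j k : n) : x j ^ 2 * y k ^ 2 * w j k ≤ N := by
    have h0 : ∀ j k, 0 ≤ x j ^ 2 * y k ^ 2 * w j k := fun j k =>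
      mul_nonneg (by positivity) (hw0 j k)
    rw [hN]
    exact (Finset.single_le_sum (f := fun k => x j ^ 2 * y k ^ 2 * w j k)
      (fun k _ => h0 j k) (Finset.mem_univ k)).trans
      (Finset.single_le_sum (f := fun j => ∑ k, x j ^ 2 * y k ^ 2 * w j k)
        (fun j _ => Finset.sum_nonneg fun k _ => h0 j k) (Finset.mem_univ j))
  have hperm (σ : Equiv.Perm n) : ∏ k, w (σ k) k ≤ N ^ Fintype.card n := by
    calc ∏ k, w (σ k) k = ∏ k, x (σ k) ^ 2 * y k ^ 2 * w (σ k) k := by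
          rw [Finset.prod_mul_distrib, Finset.prod_mul_distrib, hy,
            Equiv.prod_comp σ fun k => x k ^ 2, hx]
          ring
      _ ≤ ∏ _k : n, N := Finset.prod_le_prod
          (fun k _ => mul_nonneg (by positivity) (hw0 _ _)) fun k _ => hterm _ _
      _ = N ^ Fintype.card n := by simp
  have hcN : c ≤ F * N ^ Fintype.card n := by
    refine (hcle U hU Vᴴ (Unitary.star_mem hV)).trans ((Finset.sum_le_sum fun σ _ => hperm σ).trans ?_)
    simp [F]
  by_contra! hlt
  have hN1 := hlt.trans_le (min_le_left _ _)
  have hNc := hlt.trans_le (min_le_right _ _)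
  rw [lt_div_iff₀ hF] at hNc
  have := pow_le_of_le_one hN0 hN1.le (Fintype.card_ne_zero (α := n))
  nlinarith

lemma sum_sq_le_of_le_sum_mul_exp {n : Type*} [Fintype n] {μ : n → ℝ} {d s : ℝ} (hd : 1 ≤ d)
    (hμ : ∀ i, 0 ≤ μ i) (hsum : ∑ i, μ i = d) (hs : 0 < s) (hsd : s * d ≤ 1)
    (h : d / (1 + s ^ 2) ≤ ∑ i, μ i * Real.exp (-(s * (μ i - 1)))) :
    ∑ i, μ i ^ 2 ≤ d * (1 + s * (1 + d ^ 2)) := by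
  have hμd (i : n) : μ i ≤ d := by
    rw [← hsum]
    exact Finset.single_le_sum (fun j _ => hμ j) (Finset.mem_univ i)
  have hterm (i : n) : μ i * Real.exp (-(s * (μ i - 1))) ≤
      (1 + s + s ^ 2 * d ^ 2) * μ i - s * μ i ^ 2 := by
    have hu1 : μ i - 1 ≤ d := by linarith [hμd i]
    have hu2 : -d ≤ μ i - 1 := by linarith [hμ i]
    have hexp := (abs_le.1 (Real.abs_exp_sub_one_sub_id_le (x := -(s * (μ i - 1)))
      (abs_le.2 ⟨by nlinarith, by nlinarith⟩))).2
    have hsq : (μ i - 1) ^ 2 ≤ d ^ 2 := sq_le_sq' hu2 hu1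
    have : Real.exp (-(s * (μ i - 1))) ≤ 1 - s * (μ i - 1) + s ^ 2 * d ^ 2 := by
      nlinarith [mul_le_mul_of_nonneg_left hsq (sq_nonneg s)]
    nlinarith [mul_le_mul_of_nonneg_left this (hμ i)]
  have h1 := h.trans (Finset.sum_le_sum fun i _ => hterm i)
  rw [Finset.sum_sub_distrib, ← Finset.mul_sum, ← Finset.mul_sum, hsum] at h1
  have h2 : d * (1 - s ^ 2) ≤ d / (1 + s ^ 2) := by
    rw [le_div_iff₀ (by positivity)]
    nlinarith [mul_nonneg (zero_le_one.trans hd) (sq_nonneg (s ^ 2))]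
  refine le_of_mul_le_mul_left ?_ hs
  linarith

open scoped ComplexOrder in
lemma eigenvalues_sum_mul_conjTranspose_nonneg {n m α : Type*} [Fintype n] [DecidableEq n]
    [Fintype m] [Fintype α] (B : α → Matrix n m ℂ) (h : (∑ a, B a * (B a)ᴴ).IsHermitian) (i : n) :
    0 ≤ h.eigenvalues i :=
  Matrix.PosSemidef.eigenvalues_nonneg
    (Matrix.posSemidef_sum _ fun a _ => Matrix.posSemidef_self_mul_conjTranspose (B a)) i

lemma sum_frobSq_mul_eq_trace {k n m α : Type*} [Fintype k] [Fintype n] [Fintype m] [Fintype α]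
    (g : Matrix k n ℂ) (B : α → Matrix n m ℂ) :
    ((∑ a, frobSq (g * B a) : ℝ) : ℂ) = (g * (∑ a, B a * (B a)ᴴ) * gᴴ).trace := by
  rw [Matrix.mul_sum, Matrix.sum_mul, Matrix.trace_sum]
  push_cast
  refine Finset.sum_congr rfl fun a _ => ?_
  rw [← trace_mul_conjTranspose_self_eq, Matrix.conjTranspose_mul]
  simp only [Matrix.mul_assoc]

lemma norm_det_of_mem_unitaryGroup {n : Type*} [Fintype n] [DecidableEq n] {U : Matrix n n ℂ}
    (hU : U ∈ Matrix.unitaryGroup n ℂ) : ‖U.det‖ = 1 :=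
  CStarRing.norm_of_mem_unitary (Matrix.det_of_mem_unitary hU)

/-- A family whose total Frobenius weight is nearly minimal under left multiplication by matrices
of unit determinant is nearly balanced. -/
lemma trace_mul_self_le_of_near_min {n α : Type*} [Fintype n] [DecidableEq n] [Nonempty n]
    [Fintype α] {B : α → Matrix n n ℂ} {N m s : ℝ} (hN : N = ∑ a, frobSq (B a)) (hm : 0 < m)
    (hs : 0 < s) (hsd : s * Fintype.card n ≤ 1) (hNm : N ≤ m * (1 + s ^ 2))
    (hmin : ∀ g : Matrix n n ℂ, ‖g.det‖ = 1 → m ≤ ∑ a, frobSq (g * B a)) :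
    Fintype.card n * ((∑ a, B a * (B a)ᴴ) * ∑ a, B a * (B a)ᴴ).trace.re ≤
      N ^ 2 * (1 + s * (1 + (Fintype.card n : ℝ) ^ 2)) := by
  set d : ℝ := (Fintype.card n : ℝ) with hd
  have hd1 : 1 ≤ d := by rw [hd]; exact_mod_cast Fintype.card_pos (α := n)
  have hd0 : 0 < d := by linarith
  have hN0 : 0 < N := hm.trans_le (by simpa [hN] using hmin 1 (by simp))
  have hP : (∑ a, B a * (B a)ᴴ).IsHermitian := by
    rw [Matrix.IsHermitian, Matrix.conjTranspose_sum]
    simp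
  have hnonneg := eigenvalues_sum_mul_conjTranspose_nonneg B hP
  have htrace := sum_frobSq_mul_eq_trace (1 : Matrix n n ℂ) B
  obtain ⟨U, hU, h⟩ := hP.exists_unitary_diagonal
  have hUU := conjTranspose_mul_self_of_mem_unitaryGroup hU
  rw [hP.trace_mul_self_eq_sum, Complex.ofReal_re]
  set l := hP.eigenvalues
  have hsuml : ∑ i, l i = N := by
    simp only [Matrix.one_mul, Matrix.conjTranspose_one, Matrix.mul_one] at htrace
    rw [hP.trace_eq_sum_eigenvalues] at htrace
    rw [hN]
    exact (Complex.ofReal_injective (htrace.trans (Complex.ofReal_sum _ _).symm)).symm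
  set μ : n → ℝ := fun i => d / N * l i with hμ
  have hμsum : ∑ i, μ i = d := by
    rw [hμ, ← Finset.mul_sum, hsuml, div_mul_cancel₀ _ hN0.ne']
  set t : n → ℝ := fun i => Real.exp (-(s * (μ i - 1)) / 2)
  have htt (i : n) : t i * t i = Real.exp (-(s * (μ i - 1))) := by
    rw [← Real.exp_add]
    ring_nf
  set D : Matrix n n ℂ := Matrix.diagonal fun i => (t i : ℂ) with hD
  have hdet : ‖(D * Uᴴ).det‖ = 1 := by
    rw [Matrix.det_mul, norm_mul, Matrix.det_conjTranspose, norm_star,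
      norm_det_of_mem_unitaryGroup hU, mul_one,
      hD, Matrix.det_diagonal, ← Complex.ofReal_prod, ← Real.exp_sum, ← Finset.sum_div,
      Finset.sum_neg_distrib, ← Finset.mul_sum, Finset.sum_sub_distrib, hμsum]
    simp [hd]
  have hval : ∑ a, frobSq (D * Uᴴ * B a) = ∑ i, l i * Real.exp (-(s * (μ i - 1))) := by
    have hDH : Dᴴ = D := by
      rw [hD, Matrix.diagonal_conjTranspose]
      congr 1
      ext i
      simp
    have : D * Uᴴ * (∑ a, B a * (B a)ᴴ) * (D * Uᴴ)ᴴ =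
        D * Matrix.diagonal (fun i => (l i : ℂ)) * D := by
      rw [h, Matrix.conjTranspose_mul, Matrix.conjTranspose_conjTranspose, hDH]
      calc _ = D * (Uᴴ * U) * Matrix.diagonal (fun i => (l i : ℂ)) * (Uᴴ * U) * D := by
            simp only [Matrix.mul_assoc]
        _ = _ := by rw [hUU, Matrix.mul_one, Matrix.mul_one]
    have key := sum_frobSq_mul_eq_trace (D * Uᴴ) B
    rw [this, hD, Matrix.diagonal_mul_diagonal, Matrix.diagonal_mul_diagonal,
      Matrix.trace_diagonal] at key
    rw [← Complex.ofReal_inj, key, Complex.ofReal_sum]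
    refine Finset.sum_congr rfl fun i _ => ?_
    rw [← htt]
    push_cast
    ring
  have hle := hmin _ hdet
  rw [hval] at hle
  have hμle : d / (1 + s ^ 2) ≤ ∑ i, μ i * Real.exp (-(s * (μ i - 1))) := by
    have : ∑ i, μ i * Real.exp (-(s * (μ i - 1))) =
        d / N * ∑ i, l i * Real.exp (-(s * (μ i - 1))) := by
      rw [Finset.mul_sum]
      exact Finset.sum_congr rfl fun i _ => by rw [← mul_assoc]
    rw [this, div_le_iff₀ (by positivity), div_mul_eq_mul_div, div_mul_eq_mul_div,
      le_div_iff₀ hN0]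
    nlinarith [mul_le_mul_of_nonneg_left hle hd0.le,
      mul_le_mul_of_nonneg_left (mul_le_mul_of_nonneg_right hle (by positivity : 0 ≤ 1 + s ^ 2))
        hd0.le, mul_le_mul_of_nonneg_left hNm hd0.le]
  have hfin := sum_sq_le_of_le_sum_mul_exp hd1
    (fun i => mul_nonneg (div_nonneg hd0.le hN0.le) (hnonneg i)) hμsum hs hsd hμle
  have hsq : ∑ i, μ i ^ 2 = d ^ 2 / N ^ 2 * ∑ i, l i ^ 2 := by
    rw [Finset.mul_sum]
    exact Finset.sum_congr rfl fun i _ => by rw [hμ]; ring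
  rw [hsq, div_mul_eq_mul_div, div_le_iff₀ (by positivity)] at hfin
  refine le_of_mul_le_mul_left ?_ hd0
  linarith

lemma trace_piKron_const_re {d n : ℕ} (P : Matrix (Fin d) (Fin d) ℂ) {x : ℝ}
    (hx : P.trace = x) : (piKron fun _ : Fin n => P).trace.re = x ^ n := by
  rw [trace_piKron, Finset.prod_const, hx, ← Complex.ofReal_pow, Complex.ofReal_re,
    Finset.card_univ, Fintype.card_fin]

/-- Multiplying the factors of a tensor power on the left and on the right does not increase the
maximal rank. -/
lemma rank_le_mrk_tensorPow_of_mem_span {d n : ℕ} {α : Type*}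
    {S : Submodule ℂ (Matrix (Fin d) (Fin d) ℂ)} {A : α → Matrix (Fin d) (Fin d) ℂ}
    (hA : ∀ a, A a ∈ S) (g h : Matrix (Fin d) (Fin d) ℂ)
    {M : Matrix (Fin n → Fin d) (Fin n → Fin d) ℂ}
    (hM : M ∈ Submodule.span ℂ
      (Set.range fun I : Fin n → α => piKron fun k => g * A (I k) * h)) :
    M.rank ≤ mrk (tensorPow S n) := by
  have : ∃ M₀ ∈ tensorPow S n, M = piKron (fun _ => g) * M₀ * piKron (fun _ => h) := by
    induction hM using Submodule.span_induction with
    | zero => exact ⟨0, Submodule.zero_mem _, by simp⟩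
    | add x y _ _ hx hy =>
      obtain ⟨X, hX, rfl⟩ := hx
      obtain ⟨Y, hY, rfl⟩ := hy
      exact ⟨X + Y, Submodule.add_mem _ hX hY, by rw [Matrix.mul_add, Matrix.add_mul]⟩
    | smul c x _ hx =>
      obtain ⟨X, hX, rfl⟩ := hx
      exact ⟨c • X, Submodule.smul_mem _ c hX, by rw [Matrix.mul_smul, Matrix.smul_mul]⟩
    | mem x hx =>
      obtain ⟨I, rfl⟩ := hx
      exact ⟨piKron fun k => A (I k), piKron_mem_tensorPow fun k => hA _, by
        rw [piKron_mul, piKron_mul]⟩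
  obtain ⟨M₀, hM₀, rfl⟩ := this
  exact (Matrix.rank_mul_le_left _ _).trans
    ((Matrix.rank_mul_le_right _ _).trans (rank_le_mrk hM₀))

lemma sum_piKron_mul_conjTranspose {n : ℕ} {ι κ α : Type*} [Fintype κ] [Fintype α]
    (B : α → Matrix ι κ ℂ) :
    ∑ I : Fin n → α, (piKron fun k => B (I k)) * (piKron fun k => B (I k))ᴴ =
      piKron fun _ => ∑ a, B a * (B a)ᴴ := by
  simp only [piKron_conjTranspose, piKron_mul]
  exact sum_piKron fun a => B a * (B a)ᴴ

lemma sum_piKron_conjTranspose_mul {n : ℕ} {ι κ α : Type*} [Fintype ι] [Fintype α]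
    (B : α → Matrix ι κ ℂ) :
    ∑ I : Fin n → α, (piKron fun k => B (I k))ᴴ * (piKron fun k => B (I k)) =
      piKron fun _ => ∑ a, (B a)ᴴ * B a := by
  simp only [piKron_conjTranspose, piKron_mul]
  exact sum_piKron fun a => (B a)ᴴ * B a

lemma trace_piKron_const_mul_self_re {n : ℕ} {ι : Type*} [Fintype ι] [DecidableEq ι]
    {P : Matrix ι ι ℂ} (hP : P.IsHermitian) :
    ((piKron fun _ : Fin n => P) * piKron fun _ : Fin n => P).trace.re =
      (P * P).trace.re ^ n := by
  rw [piKron_mul, trace_piKron, Finset.prod_const, Finset.card_univ, Fintype.card_fin,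
    hP.trace_mul_self_eq_sum, ← Complex.ofReal_pow, Complex.ofReal_re, Complex.ofReal_re]

lemma mul_pow_le_mrk_tensorPow {d : ℕ} (hd : 0 < d) {S : Submodule ℂ (Matrix (Fin d) (Fin d) ℂ)}
    (hS : ¬ HasShrunkSubspace S) {s : ℝ} (hs : 0 < s) (hsd : s * d ≤ 1) (n : ℕ) :
    1 / 2 * (d / (1 + s * (1 + (d : ℝ) ^ 2))) ^ n ≤ (mrk (tensorPow S n) : ℝ) := by
  have : Nonempty (Fin d) := ⟨⟨0, hd⟩⟩
  have hd0 : (0 : ℝ) < d := by exact_mod_cast hd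
  set K : ℝ := 1 + s * (1 + (d : ℝ) ^ 2) with hK
  have hK0 : 0 < K := by positivity
  let A : Fin (Module.finrank ℂ S) → Matrix (Fin d) (Fin d) ℂ := fun a => Module.finBasis ℂ S a
  have hAS (a) : A a ∈ S := (Module.finBasis ℂ S a).2
  have hspan : Submodule.span ℂ (Set.range A) = S := by
    have : Set.range A = S.subtype '' Set.range (Module.finBasis ℂ S) := by
      rw [← Set.range_comp]
      rfl
    rw [this, Submodule.span_image, (Module.finBasis ℂ S).span_eq, Submodule.map_top,
      Submodule.range_subtype]
  rw [← hspan] at hS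
  obtain ⟨c, hc, hcle⟩ := exists_pos_le_sum_frobSq hS
  rw [hspan] at hS
  let X : Set ℝ := {x | ∃ g h : Matrix (Fin d) (Fin d) ℂ, ‖g.det‖ = 1 ∧ ‖h.det‖ = 1 ∧
    x = ∑ a, frobSq (g * A a * h)}
  have hXbdd : BddBelow X := ⟨c, by rintro _ ⟨g, h, hg, hh, rfl⟩; exact hcle g h hg hh⟩
  have hXne : X.Nonempty := ⟨_, 1, 1, by simp, by simp, rfl⟩
  have hm : 0 < sInf X := hc.trans_le (le_csInf hXne (by
    rintro _ ⟨g, h, hg, hh, rfl⟩; exact hcle g h hg hh))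
  set m := sInf X
  obtain ⟨_, ⟨g, h, hg, hh, rfl⟩, hlt⟩ := exists_lt_of_csInf_lt hXne
    (show sInf X < m * (1 + s ^ 2) by nlinarith [pow_pos hs 2])
  set B := fun a => g * A a * h with hB
  set N := ∑ a, frobSq (g * A a * h) with hN
  have hN0 : 0 < N := hm.trans_le (csInf_le hXbdd ⟨g, h, hg, hh, rfl⟩)
  have hP := trace_mul_self_le_of_near_min (B := B) hN hm hs (by simpa using hsd) hlt.le
    fun k hk => csInf_le hXbdd ⟨k * g, h, by rw [Matrix.det_mul, norm_mul, hk, hg, one_mul], hh,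
      by simp only [hB, Matrix.mul_assoc]⟩
  have hQ := trace_mul_self_le_of_near_min (B := fun a => (B a)ᴴ) (N := N)
    (by simp only [frobSq_conjTranspose]; rfl) hm hs (by simpa using hsd) hlt.le
    fun k hk => csInf_le hXbdd ⟨g, h * kᴴ, hg, by
      rw [Matrix.det_mul, norm_mul, hh, Matrix.det_conjTranspose, norm_star, hk, one_mul], by
      refine Finset.sum_congr rfl fun a _ => ?_
      rw [← frobSq_conjTranspose, Matrix.conjTranspose_mul, Matrix.conjTranspose_conjTranspose]
      simp only [hB, Matrix.mul_assoc]⟩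
  simp only [Matrix.conjTranspose_conjTranspose, Fintype.card_fin] at hP hQ
  have hPH : (∑ a, B a * (B a)ᴴ).IsHermitian := by
    rw [Matrix.IsHermitian, Matrix.conjTranspose_sum]
    simp
  have hQH : (∑ a, (B a)ᴴ * B a).IsHermitian := by
    rw [Matrix.IsHermitian, Matrix.conjTranspose_sum]
    simp
  have htr : (∑ a, B a * (B a)ᴴ).trace = (N : ℂ) := by
    simp only [Matrix.trace_sum, trace_mul_conjTranspose_self_eq]
    rw [hN, Complex.ofReal_sum]
  have main := trace_sq_le_rank_bound_mul
    (fun I : Fin n → Fin (Module.finrank ℂ S) => piKron fun k => B (I k)) (mrk (tensorPow S n))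
    fun M hM => rank_le_mrk_tensorPow_of_mem_span hAS g h hM
  rw [sum_piKron_mul_conjTranspose, sum_piKron_conjTranspose_mul,
    trace_piKron_const_mul_self_re hPH, trace_piKron_const_mul_self_re hQH,
    trace_piKron_const_re _ htr] at main
  have hP' := pow_le_pow_left₀ (trace_mul_self_re_nonneg hPH)
    ((le_div_iff₀' hd0).2 hP) n
  have hQ' := pow_le_pow_left₀ (trace_mul_self_re_nonneg hQH)
    ((le_div_iff₀' hd0).2 hQ) n
  have hle := main.trans (mul_le_mul_of_nonneg_left (add_le_add hP' hQ') (Nat.cast_nonneg _))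
  have hNn : 0 < (N ^ 2) ^ n := by positivity
  have e1 : (N ^ 2 * K / d) ^ n = (N ^ 2) ^ n * (K / d) ^ n := by rw [← mul_pow, mul_div_assoc]
  rw [← hK, e1, ← pow_mul, mul_comm n 2, pow_mul] at hle
  have e2 : (d / K) ^ n * (K / d) ^ n = 1 := by
    rw [← mul_pow, div_mul_div_cancel₀ hK0.ne', div_self hd0.ne', one_pow]
  have hKd : 0 < (K / d) ^ n := by positivity
  have h3 : 1 ≤ 2 * (mrk (tensorPow S n) : ℝ) * (K / d) ^ n := by
    refine le_of_mul_le_mul_left ?_ hNn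
    linarith
  refine le_of_mul_le_mul_right ?_ hKd
  linarith

theorem stmt19 {d : ℕ} (S : Submodule ℂ (Matrix (Fin d) (Fin d) ℂ)) (hS : S ≠ ⊥) :
    (Filter.Tendsto (fun n : ℕ => (mrk (tensorPow S n) : ℝ) ^ ((n : ℝ)⁻¹))
        Filter.atTop (nhds (d : ℝ)) ↔ ¬ HasShrunkSubspace S) ∧
    (HasShrunkSubspace S → ∃ L : ℝ, L < d ∧
      Filter.Tendsto (fun n : ℕ => (mrk (tensorPow S n) : ℝ) ^ ((n : ℝ)⁻¹))
        Filter.atTop (nhds L)) := by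
  have hd : 0 < d := by
    refine Nat.pos_of_ne_zero fun h => hS ?_
    subst h
    exact Subsingleton.elim _ _
  have hd0 : (0 : ℝ) < d := by exact_mod_cast hd
  obtain ⟨L, hL, hlim⟩ := exists_tendsto_mrk_tensorPow hS
  have hlt : HasShrunkSubspace S → L < d := fun h => by
    obtain ⟨g, hg, hgd, hle⟩ := exists_lt_mrk_tensorPow_le h
    exact (limit_le_of_le_mul_pow two_pos hg hlim hle).trans_lt hgd
  refine ⟨⟨fun h hsh => (hlt hsh).ne (tendsto_nhds_unique hlim h), fun hsh => ?_⟩,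
    fun h => ⟨L, hlt h, hlim⟩⟩
  have hdL : (d : ℝ) ≤ L := by
    have hcont : Tendsto (fun s : ℝ => (d : ℝ) / (1 + s * (1 + (d : ℝ) ^ 2))) (𝓝[>] 0)
        (𝓝 (d : ℝ)) := by
      have : ContinuousAt (fun s : ℝ => (d : ℝ) / (1 + s * (1 + (d : ℝ) ^ 2))) 0 :=
        ContinuousAt.div (by fun_prop) (by fun_prop) (by simp)
      have h0 := this.tendsto.mono_left (nhdsWithin_le_nhds (s := Set.Ioi 0))
      rwa [zero_mul, add_zero, div_one] at h0
    refine le_of_tendsto hcont ?_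
    filter_upwards [Ioo_mem_nhdsGT (inv_pos.2 hd0)] with s hs
    have hs0 : 0 < s := hs.1
    exact le_limit_of_mul_pow_le one_half_pos (by positivity) hlim
      (mul_pow_le_mrk_tensorPow hd hsh hs0
        ((mul_le_mul_of_nonneg_right hs.2.le hd0.le).trans_eq (inv_mul_cancel₀ hd0.ne')))
  rwa [le_antisymm hL hdL] at hlim
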